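/- For every constant C ∈ ℕ there exists c > 0 such that the following holds. Let m ≥ 1, let S₀,…,S_m be disjoint subsets of ℤ² with #S_j ≤ 2^j, let λ₀,…,λ_m ≥ 0, and let f = Σ_{j=0}^m λ_j 2^{−j/2} χ_{S_j}. Assume that for each j and each ξ ∈ S_j there exists at most one line ℓ through ξ with #(ℓ ∩ S_j) ≥ 2^{j/2+C}. Then Σ_{Q ∈ 𝒬⁰_{2,3}} f(Q) ≤ c (Σ_{j=0}^m λ_j²)², and the same bound holds for 𝒬⁰_{3,2}. -/

import Mathlib

open scoped BigOperators

noncomputable section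

/-- Points of the integer lattice `ℤ²`. -/
abbrev Pt := ℤ × ℤ

/-- A quadruple of lattice points, viewed as a function on `Fin 4`
(indices taken cyclically). -/
abbrev Quad := Fin 4 → Pt

/-- The embedding `ℤ² ↪ ℝ²`. -/
def emb (ξ : Pt) : ℝ × ℝ := ((ξ.1 : ℝ), (ξ.2 : ℝ))

/-- An affine line in the plane `ℝ²`. -/
def IsLine (ℓ : Set (ℝ × ℝ)) : Prop :=
  ∃ p v : ℝ × ℝ, v ≠ 0 ∧ ℓ = {x | ∃ t : ℝ, x = p + t • v}

/-- The line through two lattice points `p ≠ q` (a degenerate point if `p = q`). -/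
def lineThrough (p q : Pt) : Set (ℝ × ℝ) :=
  {x | ∃ t : ℝ, x = emb p + t • (emb q - emb p)}

/-- The number of points of a finite set `T ⊂ ℤ²` on a set `ℓ ⊂ ℝ²`,
i.e. `#(ℓ ∩ T)`. -/
def lineCount (ℓ : Set (ℝ × ℝ)) (T : Finset Pt) : ℕ :=
  (ℓ ∩ (emb '' (T : Set Pt))).ncard

/-- `Q = (ξ₁,ξ₂,ξ₃,ξ₄)` is a parallelogram: `ξ₁ + ξ₃ = ξ₂ + ξ₄`. -/
def IsPara (Q : Quad) : Prop := Q 0 + Q 2 = Q 1 + Q 3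

/-- The dot product `(ξ₁ − ξ₂)·(ξ₁ − ξ₄)`. -/
def dotQ (Q : Quad) : ℤ :=
  ((Q 0).1 - (Q 1).1) * ((Q 0).1 - (Q 3).1) + ((Q 0).2 - (Q 1).2) * ((Q 0).2 - (Q 3).2)

/-- `τ_Q = ||ξ₁|² − |ξ₂|² + |ξ₃|² − |ξ₄|²| = 2|(ξ₁−ξ₂)·(ξ₁−ξ₄)|`. -/
def tauQ (Q : Quad) : ℤ := 2 * |dotQ Q|

/-- `Q` is a rectangle: a parallelogram with `τ_Q = 0`. Membership in `𝒬⁰`. -/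
def IsRect (Q : Quad) : Prop := IsPara Q ∧ dotQ Q = 0

/-- `f(Q) = f(ξ₁)f(ξ₂)f(ξ₃)f(ξ₄)`. -/
def fQ (f : Pt → ℝ) (Q : Quad) : ℝ := ∏ k : Fin 4, f (Q k)

/-- The weight `f = ∑_{j=0}^m λ_j 2^{−j/2} χ_{S_j}`. -/
def fWt (S : ℕ → Finset Pt) (lam : ℕ → ℝ) (m : ℕ) (ξ : Pt) : ℝ :=
  ∑ j ∈ Finset.range (m + 1), if ξ ∈ S j then lam j * (2 : ℝ) ^ (-(j : ℝ) / 2) else 0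

/-- `gcd((a,b)) = gcd(|a|,|b|)` for `(a,b) ∈ ℤ²`. -/
def gcdP (ξ : Pt) : ℕ := Int.gcd ξ.1 ξ.2

/-- `max{#(ℓ(ξ,η₁) ∩ S_j), #(ℓ(ξ,η₂) ∩ S_j)}`, where `η₁, η₂` are the two
neighboring vertices of `ξ` in a rectangle. -/
def crossMax (S : ℕ → Finset Pt) (j : ℕ) (ξ η₁ η₂ : Pt) : ℕ :=
  max (lineCount (lineThrough ξ η₁) (S j)) (lineCount (lineThrough ξ η₂) (S j))

/-- `ξ` lies in some `S_j`, `j ≤ m`, and is a vertex of type `α ∈ {1,2,3}`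
relative to its neighbors `η₁, η₂`: with `a := log₂ crossMax`, type 1 means
`a ≥ j/2 + C` (i.e. `crossMax ≥ 2^{j/2+C}`), type 2 means `1 ≤ a < j/2 + C`
(i.e. `2 ≤ crossMax < 2^{j/2+C}`), and type 3 means `a = 0` (`crossMax = 1`). -/
def VertexType (S : ℕ → Finset Pt) (C m : ℕ) (α : ℕ) (ξ η₁ η₂ : Pt) : Prop :=
  ∃ j ≤ m, ξ ∈ S j ∧
    ((α = 1 ∧ (2 : ℝ) ^ ((j : ℝ) / 2 + (C : ℝ)) ≤ (crossMax S j ξ η₁ η₂ : ℝ)) ∨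
     (α = 2 ∧ 2 ≤ crossMax S j ξ η₁ η₂ ∧
        (crossMax S j ξ η₁ η₂ : ℝ) < (2 : ℝ) ^ ((j : ℝ) / 2 + (C : ℝ))) ∨
     (α = 3 ∧ crossMax S j ξ η₁ η₂ = 1))

/-- The set `𝒬⁰_{α,β}`: rectangles with four distinct vertices, all in
`∪_{j=0}^m S_j`, with `ξ₁, ξ₂` of type `α` and `ξ₃, ξ₄` of type `β`. -/
def QZeroAB (S : ℕ → Finset Pt) (C m : ℕ) (α β : ℕ) : Set Quad :=
  {Q | IsRect Q ∧ Function.Injective Q ∧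
    VertexType S C m α (Q 0) (Q 1) (Q 3) ∧
    VertexType S C m α (Q 1) (Q 2) (Q 0) ∧
    VertexType S C m β (Q 2) (Q 3) (Q 1) ∧
    VertexType S C m β (Q 3) (Q 0) (Q 2)}

/-- The set `𝒬⁰(j⃗, a⃗)`: rectangles with distinct vertices `ξ_k ∈ S_{j_k}` such
that for each `k` (cyclically), `2^{a_k} ≤ max{#(ℓ(ξ_k,ξ_{k+1}) ∩ S_{j_k}),
#(ℓ(ξ_k,ξ_{k−1}) ∩ S_{j_k})} < 2^{a_k+1}`. -/
def QZeroJA (S : ℕ → Finset Pt) (j a : Fin 4 → ℕ) : Set Quad :=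
  {Q | IsRect Q ∧ Function.Injective Q ∧ (∀ k, Q k ∈ S (j k)) ∧
    ∀ k : Fin 4,
      2 ^ (a k) ≤ max (lineCount (lineThrough (Q k) (Q (k + 1))) (S (j k)))
          (lineCount (lineThrough (Q k) (Q (k - 1))) (S (j k))) ∧
        max (lineCount (lineThrough (Q k) (Q (k + 1))) (S (j k)))
          (lineCount (lineThrough (Q k) (Q (k - 1))) (S (j k))) < 2 ^ (a k + 1)}

/-- A rectangle with nondegenerate sides whose vertices `Q 2 ∈ A` and `Q 3 ∈ B` are the only points
of `A` and `B`, respectively, on the two side lines through them. -/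
structure IsolatedPair (A B : Finset Pt) (Q : Quad) : Prop where
  para : IsPara Q
  dot : dotQ Q = 0
  ne_side : Q 2 ≠ Q 3
  ne_side' : Q 1 ≠ Q 2
  mem_two : Q 2 ∈ A
  mem_three : Q 3 ∈ B
  two_of_dot : ∀ p ∈ A, (p.1 - (Q 3).1) * ((Q 0).1 - (Q 3).1) +
    (p.2 - (Q 3).2) * ((Q 0).2 - (Q 3).2) = 0 → p = Q 2
  two_of_cross : ∀ p ∈ A, ((Q 1).1 - (Q 2).1) * (p.2 - (Q 2).2) -
    ((Q 1).2 - (Q 2).2) * (p.1 - (Q 2).1) = 0 → p = Q 2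
  three_of_dot : ∀ p ∈ B, (p.1 - (Q 2).1) * ((Q 1).1 - (Q 2).1) +
    (p.2 - (Q 2).2) * ((Q 1).2 - (Q 2).2) = 0 → p = Q 3
  three_of_cross : ∀ p ∈ B, ((Q 0).1 - (Q 3).1) * (p.2 - (Q 3).2) -
    ((Q 0).2 - (Q 3).2) * (p.1 - (Q 3).1) = 0 → p = Q 3

lemma IsPara.coords {Q : Quad} (h : IsPara Q) :
    (Q 0).1 + (Q 2).1 = (Q 1).1 + (Q 3).1 ∧ (Q 0).2 + (Q 2).2 = (Q 1).2 + (Q 3).2 := by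
  simpa [IsPara, Prod.ext_iff] using h

lemma IsPara.ext_of_coords {Q R : Quad} (hQ : IsPara Q) (hR : IsPara R)
    (h : (Q 0 = R 0 ∧ Q 1 = R 1 ∧ Q 3 = R 3) ∨ (Q 0 = R 0 ∧ Q 2 = R 2 ∧ Q 3 = R 3) ∨
      (Q 1 = R 1 ∧ Q 2 = R 2 ∧ Q 3 = R 3)) : Q = R := by
  unfold IsPara at hQ hR
  have key : Q 0 = R 0 ∧ Q 1 = R 1 ∧ Q 2 = R 2 ∧ Q 3 = R 3 := by
    rcases h with ⟨h1, h2, h3⟩ | ⟨h1, h2, h3⟩ | ⟨h1, h2, h3⟩ <;>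
      rw [h1, h2, h3, ← sub_eq_zero] at hQ <;> rw [← sub_eq_zero] at hR <;>
      refine ⟨?_, ?_, ?_, ?_⟩ <;> try assumption
    · exact sub_eq_zero.1 (by linear_combination hQ - hR)
    · exact sub_eq_zero.1 (by linear_combination hR - hQ)
    · exact sub_eq_zero.1 (by linear_combination hQ - hR)
  funext k
  fin_cases k
  exacts [key.1, key.2.1, key.2.2.1, key.2.2.2]

/-- Two vectors orthogonal to the same nonzero vector are parallel. -/
lemma cross_eq_zero_of_dot_eq_zero {a b c d e f : ℤ} (h : e ≠ 0 ∨ f ≠ 0)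
    (h₁ : a * e + b * f = 0) (h₂ : c * e + d * f = 0) : a * d - b * c = 0 := by
  rcases h with h | h
  · exact (mul_eq_zero.1 (show e * (a * d - b * c) = 0 by
      linear_combination d * h₁ - b * h₂)).resolve_left h
  · exact (mul_eq_zero.1 (show f * (a * d - b * c) = 0 by
      linear_combination a * h₂ - c * h₁)).resolve_left h

/-- If `u, v` are collinear with `q`, and also with `r`, and `u ≠ v`,
then `u - q` is parallel to `r - q`. -/
lemma cross_eq_zero_of_collinear {u v q r : Pt} (huv : u ≠ v)
    (hq : (u.1 - q.1) * (v.2 - q.2) - (u.2 - q.2) * (v.1 - q.1) = 0)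
    (hr : (u.1 - r.1) * (v.2 - r.2) - (u.2 - r.2) * (v.1 - r.1) = 0) :
    (u.1 - q.1) * (r.2 - q.2) - (u.2 - q.2) * (r.1 - q.1) = 0 := by
  have h : u.1 - v.1 ≠ 0 ∨ u.2 - v.2 ≠ 0 := by
    by_contra! h
    exact huv (Prod.ext (sub_eq_zero.1 h.1) (sub_eq_zero.1 h.2))
  rcases h with h | h
  · refine (mul_eq_zero.1 (show (u.1 - v.1) * _ = 0 from ?_)).resolve_left h
    linear_combination (u.1 - r.1) * hq - (u.1 - q.1) * hr
  · refine (mul_eq_zero.1 (show (u.2 - v.2) * _ = 0 from ?_)).resolve_left h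
    linear_combination (u.2 - r.2) * hq - (u.2 - q.2) * hr

namespace IsolatedPair

variable {A B : Finset Pt} {Q R Q' R' : Quad}

lemma dot_two (h : IsolatedPair A B Q) :
    ((Q 1).1 - (Q 2).1) * ((Q 3).1 - (Q 2).1) + ((Q 1).2 - (Q 2).2) * ((Q 3).2 - (Q 2).2) = 0 := by
  obtain ⟨h1, h2⟩ := h.para.coords
  have h3 := h.dot
  unfold dotQ at h3
  rw [show (Q 1).1 - (Q 2).1 = (Q 0).1 - (Q 3).1 by omega,
    show (Q 3).1 - (Q 2).1 = (Q 0).1 - (Q 1).1 by omega,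
    show (Q 1).2 - (Q 2).2 = (Q 0).2 - (Q 3).2 by omega,
    show (Q 3).2 - (Q 2).2 = (Q 0).2 - (Q 1).2 by omega]
  linear_combination h3

lemma dot_three (h : IsolatedPair A B Q) :
    ((Q 0).1 - (Q 3).1) * ((Q 2).1 - (Q 3).1) + ((Q 0).2 - (Q 3).2) * ((Q 2).2 - (Q 3).2) = 0 := by
  obtain ⟨h1, h2⟩ := h.para.coords
  have h3 := h.dot
  unfold dotQ at h3
  rw [show (Q 2).1 - (Q 3).1 = (Q 1).1 - (Q 0).1 by omega,
    show (Q 2).2 - (Q 3).2 = (Q 1).2 - (Q 0).2 by omega]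
  linear_combination -h3

lemma ne_coords (h : IsolatedPair A B Q) : (Q 3).1 - (Q 2).1 ≠ 0 ∨ (Q 3).2 - (Q 2).2 ≠ 0 := by
  by_contra! h'
  exact h.ne_side (Prod.ext (sub_eq_zero.1 h'.1) (sub_eq_zero.1 h'.2)).symm

lemma eq_of_zero_three (hQ : IsolatedPair A B Q) (hR : IsolatedPair A B R)
    (h0 : Q 0 = R 0) (h3 : Q 3 = R 3) : Q = R := by
  refine hQ.para.ext_of_coords hR.para (.inr <| .inl ⟨h0, ?_, h3⟩)
  refine (hQ.two_of_dot _ hR.mem_two ?_).symm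
  rw [h0, h3]
  linear_combination hR.dot_three

lemma eq_of_one_two (hQ : IsolatedPair A B Q) (hR : IsolatedPair A B R)
    (h1 : Q 1 = R 1) (h2 : Q 2 = R 2) : Q = R := by
  refine hQ.para.ext_of_coords hR.para (.inr <| .inr ⟨h1, h2, ?_⟩)
  refine (hQ.three_of_dot _ hR.mem_three ?_).symm
  rw [h1, h2]
  linear_combination hR.dot_two

lemma eq_of_zero_one (hQ : IsolatedPair A B Q) (hR : IsolatedPair A B R)
    (h0 : Q 0 = R 0) (h1 : Q 1 = R 1) : Q = R := by
  refine hQ.para.ext_of_coords hR.para (.inl ⟨h0, h1, ?_⟩)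
  refine (hQ.three_of_cross _ hR.mem_three ?_).symm
  obtain ⟨p1, p2⟩ := hQ.para.coords
  have d1 := hQ.dot_three
  have d2 := hR.dot
  unfold dotQ at d2
  rw [← h0, ← h1] at d2
  refine cross_eq_zero_of_dot_eq_zero hQ.ne_coords (by linear_combination -d1) ?_
  rw [show (Q 3).1 - (Q 2).1 = (Q 0).1 - (Q 1).1 by omega,
    show (Q 3).2 - (Q 2).2 = (Q 0).2 - (Q 1).2 by omega] at *
  rw [show (Q 2).1 = (Q 3).1 - ((Q 0).1 - (Q 1).1) by omega,
    show (Q 2).2 = (Q 3).2 - ((Q 0).2 - (Q 1).2) by omega] at d1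
  linear_combination -d2 - d1

lemma eq_of_one_one (hQ : IsolatedPair A B Q) (hQ' : IsolatedPair A B Q')
    (hR : IsolatedPair A B R) (hR' : IsolatedPair A B R') (h2 : Q' 2 = Q 2) (h3 : Q' 3 = Q 3)
    (k2 : R' 2 = R 2) (k3 : R' 3 = R 3) (hne : Q ≠ Q') (h1 : Q 1 = R 1) (h1' : Q' 1 = R' 1) :
    Q = R ∧ Q' = R' := by
  have hne1 : Q 1 ≠ Q' 1 := fun h => hne (hQ.eq_of_one_two hQ' h h2.symm)
  have e1 := hQ.dot_two
  have e2 := hQ'.dot_two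
  have f1 := hR.dot_two
  have f2 := hR'.dot_two
  rw [h2, h3] at e2
  rw [k2, k3] at f2
  have cq := cross_eq_zero_of_dot_eq_zero hQ.ne_coords e1 e2
  have cr := cross_eq_zero_of_dot_eq_zero hR.ne_coords f1 f2
  rw [← h1, ← h1'] at cr
  have h : R 2 = Q 2 := hQ.two_of_cross _ hR.mem_two (cross_eq_zero_of_collinear hne1 cq cr)
  exact ⟨hQ.eq_of_one_two hR h1 h.symm, hQ'.eq_of_one_two hR' h1' (by rw [h2, k2, h])⟩

lemma eq_of_zero_zero (hQ : IsolatedPair A B Q) (hQ' : IsolatedPair A B Q')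
    (hR : IsolatedPair A B R) (hR' : IsolatedPair A B R') (h2 : Q' 2 = Q 2) (h3 : Q' 3 = Q 3)
    (k2 : R' 2 = R 2) (k3 : R' 3 = R 3) (hne : Q ≠ Q') (h0 : Q 0 = R 0) (h0' : Q' 0 = R' 0) :
    Q = R ∧ Q' = R' := by
  have hne0 : Q 0 ≠ Q' 0 := fun h => hne (hQ.eq_of_zero_three hQ' h h3.symm)
  have e1 := hQ.dot_three
  have e2 := hQ'.dot_three
  have f1 := hR.dot_three
  have f2 := hR'.dot_three
  rw [h2, h3] at e2
  rw [k2, k3] at f2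
  have swap (a b c d : ℤ) (h : a - b ≠ 0 ∨ c - d ≠ 0) : b - a ≠ 0 ∨ d - c ≠ 0 := by omega
  have cq := cross_eq_zero_of_dot_eq_zero (swap _ _ _ _ hQ.ne_coords) e1 e2
  have cr := cross_eq_zero_of_dot_eq_zero (swap _ _ _ _ hR.ne_coords) f1 f2
  rw [← h0, ← h0'] at cr
  have h : R 3 = Q 3 := hQ.three_of_cross _ hR.mem_three (cross_eq_zero_of_collinear hne0 cq cr)
  exact ⟨hQ.eq_of_zero_three hR h0 h.symm, hQ'.eq_of_zero_three hR' h0' (by rw [h3, k3, h])⟩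

end IsolatedPair

/-- A Cauchy–Schwarz incidence bound: if pairs of distinct points in a common fibre of `g` are
determined by their `h`-values, then `#T ^ 2 ≤ #L * (#P ^ 2 + #T)`. -/
lemma card_sq_le_of_injOn_offDiag {α β γ : Type*} [DecidableEq α] [DecidableEq β]
    {T : Finset α} {L : Finset β} {P : Finset γ} {g : α → β} {h : α → γ}
    (hg : ∀ x ∈ T, g x ∈ L) (hh : ∀ x ∈ T, h x ∈ P)
    (hinj : ∀ x ∈ T, ∀ x' ∈ T, ∀ y ∈ T, ∀ y' ∈ T, g x' = g x → g y' = g y → x ≠ x' → y ≠ y' →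
      h x = h y → h x' = h y' → x = y ∧ x' = y') :
    T.card ^ 2 ≤ L.card * (P.card ^ 2 + T.card) := by
  have hT : T.card = ∑ l ∈ L, (T.filter (g · = l)).card := Finset.card_eq_sum_card_fiberwise hg
  calc T.card ^ 2 = (∑ l ∈ L, (T.filter (g · = l)).card) ^ 2 := by rw [← hT]
    _ ≤ L.card * ∑ l ∈ L, (T.filter (g · = l)).card ^ 2 := sq_sum_le_card_mul_sum_sq
    _ = L.card * ((∑ l ∈ L, (T.filter (g · = l)).offDiag.card) + T.card) := by
      conv_rhs => rw [hT]
      rw [← Finset.sum_add_distrib]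
      congr 1
      refine Finset.sum_congr rfl fun l _ => ?_
      rw [Finset.offDiag_card, sq, Nat.sub_add_cancel (Nat.le_mul_self _)]
    _ ≤ L.card * (P.card ^ 2 + T.card) := by
      gcongr
      rw [sq, ← Finset.card_product, ← Finset.card_sigma]
      refine Finset.card_le_card_of_injOn (fun z => (h z.2.1, h z.2.2)) ?_ ?_
      · rintro ⟨l, x, x'⟩ hz
        simp only [Finset.mem_coe, Finset.mem_sigma, Finset.mem_offDiag, Finset.mem_filter] at hz
        exact Finset.mem_coe.2 (Finset.mem_product.2 ⟨hh _ hz.2.1.1, hh _ hz.2.2.1.1⟩)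
      · rintro ⟨l, x, x'⟩ hz ⟨l', y, y'⟩ hw hzw
        simp only [Finset.mem_coe, Finset.mem_sigma, Finset.mem_offDiag,
          Finset.mem_filter] at hz hw
        simp only [Prod.mk.injEq] at hzw
        obtain ⟨-, ⟨hx, rfl⟩, ⟨hx', hl⟩, hne⟩ := hz
        obtain ⟨-, ⟨hy, rfl⟩, ⟨hy', hl'⟩, hne'⟩ := hw
        obtain ⟨rfl, rfl⟩ := hinj x hx x' hx' y hy y' hy' hl hl' hne hne' hzw.1 hzw.2
        rfl

/-- Lattice points `p` with `(b - a) × (p - a) = 0` lie on the line through `a ≠ b`. -/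
lemma emb_mem_lineThrough {a b p : Pt} (hab : a ≠ b)
    (h : (b.1 - a.1) * (p.2 - a.2) - (b.2 - a.2) * (p.1 - a.1) = 0) :
    emb p ∈ lineThrough a b := by
  have hR : ((b.1 : ℝ) - a.1) * (p.2 - a.2) - (b.2 - a.2) * (p.1 - a.1) = 0 := by exact_mod_cast h
  have hne : (b.1 : ℝ) - a.1 ≠ 0 ∨ (b.2 : ℝ) - a.2 ≠ 0 := by
    by_contra! h'
    refine hab (Prod.ext ?_ ?_)
    · exact_mod_cast (sub_eq_zero.1 h'.1).symm
    · exact_mod_cast (sub_eq_zero.1 h'.2).symm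
  simp only [lineThrough, emb, Set.mem_ofPred_eq, Prod.ext_iff, Prod.fst_add, Prod.snd_add,
    Prod.smul_fst, Prod.smul_snd, Prod.fst_sub, Prod.snd_sub, smul_eq_mul]
  rcases hne with hne | hne
  · refine ⟨(p.1 - a.1) / (b.1 - a.1), ?_, ?_⟩ <;> field_simp <;> linarith
  · refine ⟨(p.2 - a.2) / (b.2 - a.2), ?_, ?_⟩ <;> field_simp <;> linarith

lemma emb_injective : Function.Injective emb := fun p q h => by
  simpa [emb, Prod.ext_iff] using h

lemma eq_of_lineCount_le_one {ℓ : Set (ℝ × ℝ)} {T : Finset Pt} (h : lineCount ℓ T ≤ 1) {p q : Pt}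
    (hp : p ∈ T) (hq : q ∈ T) (hpℓ : emb p ∈ ℓ) (hqℓ : emb q ∈ ℓ) : p = q := by
  have hfin : (ℓ ∩ (emb '' (T : Set Pt))).Finite := (T.finite_toSet.image _).inter_of_right _
  exact emb_injective ((Set.ncard_le_one hfin).1 h _ ⟨hpℓ, p, hp, rfl⟩ _ ⟨hqℓ, q, hq, rfl⟩)

/-- A vertex of type 3 is the only point of its level set on either arm of its cross. -/
lemma VertexType.exists_isolated {S : ℕ → Finset Pt} {C m : ℕ} {ξ η₁ η₂ : Pt}
    (h : VertexType S C m 3 ξ η₁ η₂) (h₁ : ξ ≠ η₁) (h₂ : ξ ≠ η₂) :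
    ∃ j ≤ m, ξ ∈ S j ∧
      (∀ p ∈ S j, (η₁.1 - ξ.1) * (p.2 - ξ.2) - (η₁.2 - ξ.2) * (p.1 - ξ.1) = 0 → p = ξ) ∧
      ∀ p ∈ S j, (η₂.1 - ξ.1) * (p.2 - ξ.2) - (η₂.2 - ξ.2) * (p.1 - ξ.1) = 0 → p = ξ := by
  obtain ⟨j, hj, hξ, h⟩ := h
  have hc : crossMax S j ξ η₁ η₂ = 1 := by
    rcases h with ⟨h, -⟩ | ⟨h, -⟩ | ⟨-, h⟩
    · omega
    · omega
    · exact h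
  have self (η : Pt) : emb ξ ∈ lineThrough ξ η := ⟨0, by simp⟩
  exact ⟨j, hj, hξ, fun p hp hpx => eq_of_lineCount_le_one ((le_max_left _ _).trans hc.le) hp hξ
      (emb_mem_lineThrough h₁ hpx) (self _),
    fun p hp hpx => eq_of_lineCount_le_one ((le_max_right _ _).trans hc.le) hp hξ
      (emb_mem_lineThrough h₂ hpx) (self _)⟩

lemma exists_isolatedPair {S : ℕ → Finset Pt} {C m α : ℕ} {Q : Quad}
    (hQ : Q ∈ QZeroAB S C m α 3) :
    ∃ a ≤ m, ∃ b ≤ m, ∃ c ≤ m, ∃ d ≤ m, Q 0 ∈ S a ∧ Q 1 ∈ S b ∧ IsolatedPair (S c) (S d) Q := by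
  obtain ⟨⟨hpara, hdot⟩, hinj, ⟨a, ha, h0, -⟩, ⟨b, hb, h1, -⟩, h2, h3⟩ := hQ
  obtain ⟨c, hc, hc2, c1, c2⟩ := h2.exists_isolated (hinj.ne (by decide)) (hinj.ne (by decide))
  obtain ⟨d, hd, hd3, d1, d2⟩ := h3.exists_isolated (hinj.ne (by decide)) (hinj.ne (by decide))
  refine ⟨a, ha, b, hb, c, hc, d, hd, h0, h1, hpara, hdot, hinj.ne (by decide),
    hinj.ne (by decide), hc2, hd3, fun p hp h => c1 p hp ?_, c2, fun p hp h => d2 p hp ?_, d1⟩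
  all_goals
    obtain ⟨p1, p2⟩ := hpara.coords
    unfold dotQ at hdot
  · have hne : (Q 0).1 - (Q 3).1 ≠ 0 ∨ (Q 0).2 - (Q 3).2 ≠ 0 := by
      by_contra! h'
      exact hinj.ne (show (0 : Fin 4) ≠ 3 by decide)
        (Prod.ext (sub_eq_zero.1 h'.1) (sub_eq_zero.1 h'.2))
    have e2 : ((Q 3).1 - (Q 2).1) * ((Q 0).1 - (Q 3).1) +
        ((Q 3).2 - (Q 2).2) * ((Q 0).2 - (Q 3).2) = 0 := by
      rw [show (Q 3).1 - (Q 2).1 = (Q 0).1 - (Q 1).1 by omega,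
        show (Q 3).2 - (Q 2).2 = (Q 0).2 - (Q 1).2 by omega]
      exact hdot
    exact cross_eq_zero_of_dot_eq_zero hne e2 (by linear_combination h + e2)
  · have hne : (Q 1).1 - (Q 2).1 ≠ 0 ∨ (Q 1).2 - (Q 2).2 ≠ 0 := by
      by_contra! h'
      exact hinj.ne (show (1 : Fin 4) ≠ 2 by decide)
        (Prod.ext (sub_eq_zero.1 h'.1) (sub_eq_zero.1 h'.2))
    have e2 : ((Q 2).1 - (Q 3).1) * ((Q 1).1 - (Q 2).1) +
        ((Q 2).2 - (Q 3).2) * ((Q 1).2 - (Q 2).2) = 0 := by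
      rw [show (Q 2).1 - (Q 3).1 = (Q 1).1 - (Q 0).1 by omega,
        show (Q 2).2 - (Q 3).2 = (Q 1).2 - (Q 0).2 by omega,
        show (Q 1).1 - (Q 2).1 = (Q 0).1 - (Q 3).1 by omega,
        show (Q 1).2 - (Q 2).2 = (Q 0).2 - (Q 3).2 by omega]
      linear_combination -hdot
    exact cross_eq_zero_of_dot_eq_zero hne e2 (by linear_combination h + e2)

open Classical in
/-- The rectangles with `Q 0 ∈ A₀`, `Q 1 ∈ A₁` and `Q 2 ∈ A₂`, `Q 3 ∈ A₃` isolated. -/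
def isolatedQuads (A₀ A₁ A₂ A₃ : Finset Pt) : Finset Quad :=
  (Fintype.piFinset ![A₀, A₁, A₂, A₃]).filter (IsolatedPair A₂ A₃)

lemma mem_isolatedQuads {A₀ A₁ A₂ A₃ : Finset Pt} {Q : Quad} :
    Q ∈ isolatedQuads A₀ A₁ A₂ A₃ ↔ Q 0 ∈ A₀ ∧ Q 1 ∈ A₁ ∧ IsolatedPair A₂ A₃ Q := by
  simp only [isolatedQuads, Finset.mem_filter, Fintype.mem_piFinset, Fin.forall_fin_succ]
  simp only [Fin.isValue, Matrix.cons_val_zero, Matrix.cons_val_succ, IsEmpty.forall_iff, and_true]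
  exact ⟨fun h => ⟨h.1.1, h.1.2.1, h.2⟩,
    fun h => ⟨⟨h.1, h.2.1, h.2.2.mem_two, h.2.2.mem_three⟩, h.2.2⟩⟩

section CardBounds

variable (A₀ A₁ A₂ A₃ : Finset Pt)

lemma card_isolatedQuads_le_zero_one :
    (isolatedQuads A₀ A₁ A₂ A₃).card ≤ A₀.card * A₁.card := by
  rw [← Finset.card_product]
  refine Finset.card_le_card_of_injOn (fun Q => (Q 0, Q 1)) (fun Q hQ => ?_)
    fun Q hQ R hR h => ?_
  · have := mem_isolatedQuads.1 hQ
    exact Finset.mem_coe.2 (Finset.mem_product.2 ⟨this.1, this.2.1⟩)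
  · exact (mem_isolatedQuads.1 hQ).2.2.eq_of_zero_one (mem_isolatedQuads.1 hR).2.2
      (Prod.ext_iff.1 h).1 (Prod.ext_iff.1 h).2

lemma card_isolatedQuads_le_zero_three :
    (isolatedQuads A₀ A₁ A₂ A₃).card ≤ A₀.card * A₃.card := by
  rw [← Finset.card_product]
  refine Finset.card_le_card_of_injOn (fun Q => (Q 0, Q 3)) (fun Q hQ => ?_)
    fun Q hQ R hR h => ?_
  · have := mem_isolatedQuads.1 hQ
    exact Finset.mem_coe.2 (Finset.mem_product.2 ⟨this.1, this.2.2.mem_three⟩)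
  · exact (mem_isolatedQuads.1 hQ).2.2.eq_of_zero_three (mem_isolatedQuads.1 hR).2.2
      (Prod.ext_iff.1 h).1 (Prod.ext_iff.1 h).2

lemma card_isolatedQuads_le_one_two :
    (isolatedQuads A₀ A₁ A₂ A₃).card ≤ A₁.card * A₂.card := by
  rw [← Finset.card_product]
  refine Finset.card_le_card_of_injOn (fun Q => (Q 1, Q 2)) (fun Q hQ => ?_)
    fun Q hQ R hR h => ?_
  · have := mem_isolatedQuads.1 hQ
    exact Finset.mem_coe.2 (Finset.mem_product.2 ⟨this.2.1, this.2.2.mem_two⟩)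
  · exact (mem_isolatedQuads.1 hQ).2.2.eq_of_one_two (mem_isolatedQuads.1 hR).2.2
      (Prod.ext_iff.1 h).1 (Prod.ext_iff.1 h).2

lemma card_isolatedQuads_sq_le_zero :
    (isolatedQuads A₀ A₁ A₂ A₃).card ^ 2 ≤
      A₂.card * A₃.card * (A₀.card ^ 2 + (isolatedQuads A₀ A₁ A₂ A₃).card) := by
  rw [← Finset.card_product A₂ A₃]
  refine card_sq_le_of_injOn_offDiag (g := fun Q => (Q 2, Q 3)) (h := fun Q => Q 0)
    (fun Q hQ => ?_) (fun Q hQ => (mem_isolatedQuads.1 hQ).1) ?_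
  · have := (mem_isolatedQuads.1 hQ).2.2
    exact Finset.mem_product.2 ⟨this.mem_two, this.mem_three⟩
  · intro Q hQ Q' hQ' R hR R' hR' h k hne _ h0 h0'
    rw [mem_isolatedQuads] at hQ hQ' hR hR'
    exact hQ.2.2.eq_of_zero_zero hQ'.2.2 hR.2.2 hR'.2.2 (Prod.ext_iff.1 h).1 (Prod.ext_iff.1 h).2
      (Prod.ext_iff.1 k).1 (Prod.ext_iff.1 k).2 hne h0 h0'

lemma card_isolatedQuads_sq_le_one :
    (isolatedQuads A₀ A₁ A₂ A₃).card ^ 2 ≤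
      A₂.card * A₃.card * (A₁.card ^ 2 + (isolatedQuads A₀ A₁ A₂ A₃).card) := by
  rw [← Finset.card_product A₂ A₃]
  refine card_sq_le_of_injOn_offDiag (g := fun Q => (Q 2, Q 3)) (h := fun Q => Q 1)
    (fun Q hQ => ?_) (fun Q hQ => (mem_isolatedQuads.1 hQ).2.1) ?_
  · have := (mem_isolatedQuads.1 hQ).2.2
    exact Finset.mem_product.2 ⟨this.mem_two, this.mem_three⟩
  · intro Q hQ Q' hQ' R hR R' hR' h k hne _ h1 h1'
    rw [mem_isolatedQuads] at hQ hQ' hR hR'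
    exact hQ.2.2.eq_of_one_one hQ'.2.2 hR.2.2 hR'.2.2 (Prod.ext_iff.1 h).1 (Prod.ext_iff.1 h).2
      (Prod.ext_iff.1 k).1 (Prod.ext_iff.1 k).2 hne h1 h1'

end CardBounds

/-- An exponentially decaying kernel on `ℕ × ℕ`. -/
def decay (a b : ℕ) : ℝ := (2 : ℝ) ^ (-|(a : ℝ) - b| / 8)

lemma decay_nonneg (a b : ℕ) : 0 ≤ decay a b := by unfold decay; positivity

lemma decay_comm (a b : ℕ) : decay a b = decay b a := by rw [decay, decay, abs_sub_comm]

lemma decay_add_right (a n : ℕ) : decay a (a + n) = ((2 : ℝ) ^ (-(1 : ℝ) / 8)) ^ n := by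
  rw [decay, ← Real.rpow_natCast, ← Real.rpow_mul (by norm_num)]
  congr 1
  push_cast
  rw [show (a : ℝ) - (a + n) = -n by ring, abs_neg, Nat.abs_cast]
  ring

/-- The row sums of `decay` are uniformly bounded. -/
lemma exists_sum_decay_le : ∃ K : ℝ, 0 < K ∧ ∀ n a : ℕ, ∑ b ∈ Finset.range n, decay a b ≤ K := by
  set r : ℝ := (2 : ℝ) ^ (-(1 : ℝ) / 8)
  have hr0 : 0 ≤ r := by positivity
  have hr1 : r < 1 := Real.rpow_lt_one_of_one_lt_of_neg (by norm_num) (by norm_num)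
  have hs := summable_geometric_of_lt_one hr0 hr1
  have hpos : 0 < (1 - r)⁻¹ := inv_pos.2 (by linarith)
  have fibre (s : Finset ℕ) (g : ℕ → ℕ) (hg : Set.InjOn g s) : ∑ b ∈ s, r ^ g b ≤ (1 - r)⁻¹ := by
    rw [← Finset.sum_image (f := fun i => r ^ i) hg, ← tsum_geometric_of_lt_one hr0 hr1]
    exact hs.sum_le_tsum _ fun _ _ => by positivity
  refine ⟨(1 - r)⁻¹ + (1 - r)⁻¹, by positivity, fun n a => ?_⟩
  rw [← Finset.sum_filter_add_sum_filter_not _ (a ≤ ·)]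
  refine add_le_add ?_ ?_
  · refine le_of_eq_of_le (Finset.sum_congr rfl fun b hb => ?_)
      (fibre _ (fun b => b - a) fun b hb c hc h => ?_)
    · have hab := (Finset.mem_filter.1 hb).2
      conv_lhs => rw [← Nat.add_sub_cancel' hab, decay_add_right]
    · simp only [Finset.coe_filter, Set.mem_ofPred_eq] at hb hc h
      omega
  · refine le_of_eq_of_le (Finset.sum_congr rfl fun b hb => ?_)
      (fibre _ (fun b => a - b) fun b hb c hc h => ?_)
    · have hab := (not_le.1 (Finset.mem_filter.1 hb).2).le
      conv_lhs => rw [decay_comm, ← Nat.add_sub_cancel' hab, decay_add_right]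
    · simp only [Finset.coe_filter, Set.mem_ofPred_eq] at hb hc h
      omega

/-- Schur's test for `decay`. -/
lemma sum_mul_decay_le {K : ℝ} (hK : ∀ n a : ℕ, ∑ b ∈ Finset.range n, decay a b ≤ K) (n : ℕ)
    (u : ℕ → ℝ) :
    ∑ a ∈ Finset.range n, ∑ b ∈ Finset.range n, u a * u b * decay a b ≤
      K * ∑ a ∈ Finset.range n, u a ^ 2 := by
  have row : ∑ a ∈ Finset.range n, ∑ b ∈ Finset.range n, u a ^ 2 * decay a b ≤
      K * ∑ a ∈ Finset.range n, u a ^ 2 := by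
    rw [Finset.mul_sum]
    refine Finset.sum_le_sum fun a _ => ?_
    rw [← Finset.mul_sum, mul_comm]
    exact mul_le_mul_of_nonneg_right (hK n a) (sq_nonneg _)
  have col : ∑ a ∈ Finset.range n, ∑ b ∈ Finset.range n, u b ^ 2 * decay a b ≤
      K * ∑ a ∈ Finset.range n, u a ^ 2 := by
    rw [Finset.sum_comm]
    simpa only [decay_comm] using row
  have amgm : ∑ a ∈ Finset.range n, ∑ b ∈ Finset.range n, u a * u b * decay a b ≤
      (∑ a ∈ Finset.range n, ∑ b ∈ Finset.range n, u a ^ 2 * decay a b +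
        ∑ a ∈ Finset.range n, ∑ b ∈ Finset.range n, u b ^ 2 * decay a b) / 2 := by
    rw [← Finset.sum_add_distrib, Finset.sum_div]
    refine Finset.sum_le_sum fun a _ => ?_
    rw [← Finset.sum_add_distrib, Finset.sum_div]
    refine Finset.sum_le_sum fun b _ => ?_
    nlinarith [mul_nonneg (sq_nonneg (u a - u b)) (decay_nonneg a b)]
  linarith

/-- Normalised off-diagonal decay of a count obeying the five incidence bounds. -/
lemma mul_rpow_le_decay {N a b c d : ℕ} (h₁ : N ≤ 2 ^ a * 2 ^ b) (h₂ : N ≤ 2 ^ a * 2 ^ d)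
    (h₃ : N ≤ 2 ^ b * 2 ^ c) (h₄ : N ^ 2 ≤ 2 ^ c * 2 ^ d * ((2 ^ a) ^ 2 + N))
    (h₅ : N ^ 2 ≤ 2 ^ c * 2 ^ d * ((2 ^ b) ^ 2 + N)) :
    (N : ℝ) * (2 : ℝ) ^ (-((a : ℝ) + b + c + d) / 2) ≤
      2 * (decay a b * decay c d + decay a c * decay b d) := by
  rcases Nat.eq_zero_or_pos N with rfl | hN
  · have := mul_nonneg (decay_nonneg a b) (decay_nonneg c d)
    have := mul_nonneg (decay_nonneg a c) (decay_nonneg b d)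
    simp only [Nat.cast_zero, zero_mul]
    linarith
  obtain ⟨n, hn⟩ : ∃ n : ℝ, (2 : ℝ) ^ n = N :=
    ⟨Real.logb 2 N, Real.rpow_logb (by norm_num) (by norm_num) (by exact_mod_cast hN)⟩
  have two_pow (k : ℕ) : (2 : ℝ) ^ k = (2 : ℝ) ^ (k : ℝ) := (Real.rpow_natCast 2 k).symm
  have le_of {x y : ℝ} (h : (2 : ℝ) ^ x ≤ (2 : ℝ) ^ y) : x ≤ y :=
    (Real.rpow_le_rpow_left_iff (by norm_num)).1 h
  have two_rpow_add (x y : ℝ) : (2 : ℝ) ^ (x + y) = 2 ^ x * 2 ^ y := Real.rpow_add (by norm_num) x y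
  have pair {i j : ℕ} (h : N ≤ 2 ^ i * 2 ^ j) : n ≤ i + j := by
    refine le_of ?_
    rw [hn, two_rpow_add, ← two_pow, ← two_pow]
    exact_mod_cast h
  have quad {i : ℕ} (h : N ^ 2 ≤ 2 ^ c * 2 ^ d * ((2 ^ i) ^ 2 + N)) :
      2 * n ≤ 1 + c + d + 2 * i ∨ n ≤ 1 + c + d := by
    rcases le_total N ((2 ^ i) ^ 2) with hi | hi
    · left
      refine le_of ?_
      rw [two_mul, two_mul, two_rpow_add, hn, two_rpow_add, two_rpow_add, two_rpow_add,
        two_rpow_add, ← two_pow, ← two_pow, ← two_pow, Real.rpow_one]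
      have : N * N ≤ 2 * 2 ^ c * 2 ^ d * (2 ^ i * 2 ^ i) := by
        nlinarith [Nat.mul_le_mul_left (2 ^ c * 2 ^ d) hi]
      exact_mod_cast this
    · right
      refine le_of ?_
      rw [hn, two_rpow_add, two_rpow_add, ← two_pow, ← two_pow, Real.rpow_one]
      have : N ≤ 2 * 2 ^ c * 2 ^ d := by
        refine Nat.le_of_mul_le_mul_right (c := N) ?_ hN
        nlinarith [Nat.mul_le_mul_left (2 ^ c * 2 ^ d) hi]
      exact_mod_cast this
  have p₁ := pair h₁
  have p₂ := pair h₂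
  have p₃ := pair h₃
  have lhs : (N : ℝ) * (2 : ℝ) ^ (-((a : ℝ) + b + c + d) / 2) =
      2 ^ (n + -((a : ℝ) + b + c + d) / 2) := by rw [two_rpow_add, hn]
  have rhs (i j k l : ℕ) : 2 * (decay i j * decay k l) =
      2 ^ (1 + (-|(i : ℝ) - j| / 8 + -|(k : ℝ) - l| / 8)) := by
    rw [two_rpow_add, two_rpow_add, Real.rpow_one, decay, decay]
  have close (i j k l : ℕ)
      (h : n + -((a : ℝ) + b + c + d) / 2 ≤ 1 + (-|(i : ℝ) - j| / 8 + -|(k : ℝ) - l| / 8)) :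
      (N : ℝ) * (2 : ℝ) ^ (-((a : ℝ) + b + c + d) / 2) ≤ 2 * (decay i j * decay k l) := by
    rw [lhs, rhs]
    exact Real.rpow_le_rpow_of_exponent_le (by norm_num) h
  have nonneg (i j k l : ℕ) : 0 ≤ 2 * (decay i j * decay k l) := by rw [rhs]; positivity
  have far (h : n ≤ 1 + c + d) : (N : ℝ) * (2 : ℝ) ^ (-((a : ℝ) + b + c + d) / 2) ≤
      2 * (decay a b * decay c d + decay a c * decay b d) := by
    refine (close a c b d ?_).trans (by linarith [nonneg a b c d])
    rcases abs_cases ((a : ℝ) - c) with h' | h' <;> rcases abs_cases ((b : ℝ) - d) with h'' | h'' <;>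
      linarith
  rcases quad h₄ with h | h
  · rcases quad h₅ with h' | h'
    · refine (close a b c d ?_).trans (by linarith [nonneg a c b d])
      rcases abs_cases ((a : ℝ) - b) with k | k <;> rcases abs_cases ((c : ℝ) - d) with k' | k' <;>
        linarith
    · exact far h'
  · exact far h

lemma card_isolatedQuads_mul_le {A₀ A₁ A₂ A₃ : Finset Pt} {a b c d : ℕ} (h₀ : A₀.card ≤ 2 ^ a)
    (h₁ : A₁.card ≤ 2 ^ b) (h₂ : A₂.card ≤ 2 ^ c) (h₃ : A₃.card ≤ 2 ^ d) :
    ((isolatedQuads A₀ A₁ A₂ A₃).card : ℝ) * (2 : ℝ) ^ (-((a : ℝ) + b + c + d) / 2) ≤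
      2 * (decay a b * decay c d + decay a c * decay b d) := by
  apply mul_rpow_le_decay
  · exact (card_isolatedQuads_le_zero_one ..).trans (by gcongr)
  · exact (card_isolatedQuads_le_zero_three ..).trans (by gcongr)
  · exact (card_isolatedQuads_le_one_two ..).trans (by gcongr)
  · exact (card_isolatedQuads_sq_le_zero ..).trans (by gcongr)
  · exact (card_isolatedQuads_sq_le_one ..).trans (by gcongr)

lemma fWt_eq {S : ℕ → Finset Pt} {lam : ℕ → ℝ} {m : ℕ}
    (hS : ∀ i ≤ m, ∀ j ≤ m, i ≠ j → Disjoint (S i) (S j)) {j : ℕ} (hj : j ≤ m) {ξ : Pt}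
    (hξ : ξ ∈ S j) : fWt S lam m ξ = lam j * (2 : ℝ) ^ (-(j : ℝ) / 2) := by
  rw [fWt, Finset.sum_eq_single_of_mem j (Finset.mem_range.2 (by omega)), if_pos hξ]
  intro i hi hij
  rw [if_neg fun h => Finset.disjoint_left.1 (hS i (by grind) j hj hij) h hξ]

/-- Rectangles whose last two vertices have type 3. -/
lemma tsum_indicator_QZeroAB_three_le {K : ℝ}
    (hK : ∀ n a : ℕ, ∑ b ∈ Finset.range n, decay a b ≤ K) {C m α : ℕ} {S : ℕ → Finset Pt}
    {lam : ℕ → ℝ} (hS : ∀ i ≤ m, ∀ j ≤ m, i ≠ j → Disjoint (S i) (S j))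
    (hcard : ∀ j ≤ m, (S j).card ≤ 2 ^ j) (hlam : ∀ j ≤ m, 0 ≤ lam j) :
    ∑' Q : Quad, Set.indicator (QZeroAB S C m α 3) (fQ (fWt S lam m)) Q ≤
      4 * K ^ 2 * (∑ j ∈ Finset.range (m + 1), lam j ^ 2) ^ 2 := by
  classical
  set I := Finset.range (m + 1)
  have hI {j : ℕ} : j ∈ I ↔ j ≤ m := by simp [I]
  set w : ℕ → ℝ := fun j => lam j * (2 : ℝ) ^ (-(j : ℝ) / 2) with hw
  have hw0 {j : ℕ} (hj : j ∈ I) : 0 ≤ w j := mul_nonneg (hlam j (hI.1 hj)) (by positivity)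
  set T : (ℕ × ℕ) × (ℕ × ℕ) → Finset Quad :=
    fun i => isolatedQuads (S i.1.1) (S i.1.2) (S i.2.1) (S i.2.2)
  set W : (ℕ × ℕ) × (ℕ × ℕ) → ℝ := fun i => w i.1.1 * w i.1.2 * (w i.2.1 * w i.2.2)
  set J := (I ×ˢ I) ×ˢ (I ×ˢ I)
  have hJ {i : (ℕ × ℕ) × (ℕ × ℕ)} (hi : i ∈ J) :
      (i.1.1 ∈ I ∧ i.1.2 ∈ I) ∧ (i.2.1 ∈ I ∧ i.2.2 ∈ I) := by
    simpa only [J, Finset.mem_product] using hi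
  have hW0 {i : (ℕ × ℕ) × (ℕ × ℕ)} (hi : i ∈ J) : 0 ≤ W i := by
    obtain ⟨⟨h0, h1⟩, h2, h3⟩ := hJ hi
    exact mul_nonneg (mul_nonneg (hw0 h0) (hw0 h1)) (mul_nonneg (hw0 h2) (hw0 h3))
  have cover {Q : Quad} (hQ : Q ∈ QZeroAB S C m α 3) :
      ∃ i ∈ J, Q ∈ T i ∧ fQ (fWt S lam m) Q = W i := by
    obtain ⟨a, ha, b, hb, c, hc, d, hd, h0, h1, h⟩ := exists_isolatedPair hQ
    refine ⟨((a, b), (c, d)), ?_, mem_isolatedQuads.2 ⟨h0, h1, h⟩, ?_⟩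
    · simp only [J, Finset.mem_product, hI]
      exact ⟨⟨ha, hb⟩, hc, hd⟩
    · rw [fQ, Fin.prod_univ_four, fWt_eq hS ha h0, fWt_eq hS hb h1, fWt_eq hS hc h.mem_two,
        fWt_eq hS hd h.mem_three, mul_assoc]
  have tsum_le : ∑' Q : Quad, Set.indicator (QZeroAB S C m α 3) (fQ (fWt S lam m)) Q ≤
      ∑ i ∈ J, (T i).card * W i := by
    rw [tsum_eq_sum (s := J.biUnion T) fun Q hQ => Set.indicator_of_notMem (fun h => hQ ?_) _]
    · calc ∑ Q ∈ J.biUnion T, Set.indicator (QZeroAB S C m α 3) (fQ (fWt S lam m)) Q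
        _ ≤ ∑ Q ∈ J.biUnion T, ∑ i ∈ J, if Q ∈ T i then W i else 0 := by
          refine Finset.sum_le_sum fun Q _ => ?_
          have nonneg : ∀ i ∈ J, 0 ≤ if Q ∈ T i then W i else 0 := fun i hi => by
            split_ifs
            exacts [hW0 hi, le_rfl]
          by_cases h : Q ∈ QZeroAB S C m α 3
          · obtain ⟨i, hi, hQi, hfi⟩ := cover h
            rw [Set.indicator_of_mem h, hfi]
            simpa only [if_pos hQi] using Finset.single_le_sum nonneg hi
          · rw [Set.indicator_of_notMem h]
            exact Finset.sum_nonneg nonneg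
        _ = ∑ i ∈ J, (T i).card * W i := by
          rw [Finset.sum_comm]
          refine Finset.sum_congr rfl fun i hi => ?_
          rw [← Finset.sum_filter, Finset.filter_mem_eq_inter,
            Finset.inter_eq_right.2 (Finset.subset_biUnion_of_mem T hi), Finset.sum_const,
            nsmul_eq_mul]
    · obtain ⟨i, hi, hQi, -⟩ := cover h
      exact Finset.mem_biUnion.2 ⟨i, hi, hQi⟩
  have term_le : ∀ i ∈ J, (T i).card * W i ≤
      2 * ((lam i.1.1 * lam i.1.2 * decay i.1.1 i.1.2) *
          (lam i.2.1 * lam i.2.2 * decay i.2.1 i.2.2) +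
        (lam i.1.1 * lam i.2.1 * decay i.1.1 i.2.1) *
          (lam i.1.2 * lam i.2.2 * decay i.1.2 i.2.2)) := by
    rintro ⟨⟨a, b⟩, c, d⟩ hi
    obtain ⟨⟨ha, hb⟩, hc, hd⟩ := hJ hi
    simp only [hI] at ha hb hc hd ⊢
    have hl : 0 ≤ lam a * lam b * (lam c * lam d) :=
      mul_nonneg (mul_nonneg (hlam a ha) (hlam b hb)) (mul_nonneg (hlam c hc) (hlam d hd))
    have key := mul_le_mul_of_nonneg_left
      (card_isolatedQuads_mul_le (hcard a ha) (hcard b hb) (hcard c hc) (hcard d hd)) hl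
    have split : (2 : ℝ) ^ (-((a : ℝ) + b + c + d) / 2) = 2 ^ (-(a : ℝ) / 2) * 2 ^ (-(b : ℝ) / 2) *
        (2 ^ (-(c : ℝ) / 2) * 2 ^ (-(d : ℝ) / 2)) := by
      rw [← Real.rpow_add two_pos, ← Real.rpow_add two_pos, ← Real.rpow_add two_pos]
      congr 1
      ring
    rw [split] at key
    simp only [T, W, hw]
    linarith
  set X := ∑ a ∈ I, ∑ b ∈ I, lam a * lam b * decay a b with hX
  have hX0 : 0 ≤ X := Finset.sum_nonneg fun a ha => Finset.sum_nonneg fun b hb =>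
    mul_nonneg (mul_nonneg (hlam a (hI.1 ha)) (hlam b (hI.1 hb))) (decay_nonneg a b)
  have hXK : X ≤ K * ∑ j ∈ I, lam j ^ 2 := sum_mul_decay_le hK (m + 1) lam
  have sum_fst : ∑ i ∈ J, (lam i.1.1 * lam i.1.2 * decay i.1.1 i.1.2) *
      (lam i.2.1 * lam i.2.2 * decay i.2.1 i.2.2) = X * X := by
    rw [hX, ← Finset.sum_product', Finset.sum_mul_sum, ← Finset.sum_product']
  have sum_snd : ∑ i ∈ J, (lam i.1.1 * lam i.2.1 * decay i.1.1 i.2.1) *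
      (lam i.1.2 * lam i.2.2 * decay i.1.2 i.2.2) = X * X := by
    rw [Finset.sum_product, Finset.sum_product, hX, Finset.sum_mul_sum]
    refine Finset.sum_congr rfl fun a _ => Finset.sum_congr rfl fun b _ => ?_
    rw [Finset.sum_mul_sum, Finset.sum_product]
  calc _ ≤ _ := tsum_le
    _ ≤ _ := Finset.sum_le_sum term_le
    _ = 4 * X ^ 2 := by
      rw [← Finset.mul_sum, Finset.sum_add_distrib, sum_fst, sum_snd]
      ring
    _ ≤ 4 * (K * ∑ j ∈ I, lam j ^ 2) ^ 2 := by gcongr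
    _ = _ := by ring

/-- Rotating a rectangle by two vertices exchanges the two pairs of types. -/
lemma comp_add_two_mem_QZeroAB {S : ℕ → Finset Pt} {C m α β : ℕ} {Q : Quad} :
    Q ∘ Equiv.addRight 2 ∈ QZeroAB S C m α β ↔ Q ∈ QZeroAB S C m β α := by
  have h0 : (Q ∘ Equiv.addRight 2) 0 = Q 2 := rfl
  have h1 : (Q ∘ Equiv.addRight 2) 1 = Q 3 := rfl
  have h2 : (Q ∘ Equiv.addRight 2) 2 = Q 0 := rfl
  have h3 : (Q ∘ Equiv.addRight 2) 3 = Q 1 := rfl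
  have hpara : IsPara (Q ∘ Equiv.addRight 2) ↔ IsPara Q := by
    rw [IsPara, IsPara, h0, h1, h2, h3, add_comm (Q 2), add_comm (Q 3)]
  have hrect : IsRect (Q ∘ Equiv.addRight 2) ↔ IsRect Q := by
    rw [IsRect, IsRect, hpara]
    refine and_congr_right fun h => ?_
    obtain ⟨p1, p2⟩ := h.coords
    rw [dotQ, dotQ, h0, h1, h3, show (Q 2).1 - (Q 3).1 = (Q 1).1 - (Q 0).1 by omega,
      show (Q 2).2 - (Q 3).2 = (Q 1).2 - (Q 0).2 by omega,
      show (Q 2).1 - (Q 1).1 = (Q 3).1 - (Q 0).1 by omega,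
      show (Q 2).2 - (Q 1).2 = (Q 3).2 - (Q 0).2 by omega]
    ring_nf
  simp only [QZeroAB, Set.mem_ofPred_eq, hrect, h0, h1, h2, h3, Equiv.injective_comp]
  tauto

lemma tsum_indicator_QZeroAB_swap (S : ℕ → Finset Pt) (C m α β : ℕ) (f : Pt → ℝ) :
    ∑' Q : Quad, Set.indicator (QZeroAB S C m α β) (fQ f) Q =
      ∑' Q : Quad, Set.indicator (QZeroAB S C m β α) (fQ f) Q := by
  rw [← ((Equiv.addRight (2 : Fin 4)).arrowCongr (Equiv.refl Pt)).symm.tsum_eq]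
  refine tsum_congr fun Q => ?_
  change Set.indicator _ _ (Q ∘ Equiv.addRight 2) = _
  have hf : fQ f (Q ∘ Equiv.addRight 2) = fQ f Q :=
    Equiv.prod_comp (Equiv.addRight (2 : Fin 4)) fun k => f (Q k)
  classical
  simp only [Set.indicator_apply, comp_add_two_mem_QZeroAB, hf]

/-- **Case IV of Lemma 3.3.** `Σ_{Q ∈ 𝒬⁰_{2,3}} f(Q) ≲ ‖λ‖_{ℓ²}⁴`, and the same
bound for `𝒬⁰_{3,2}`. -/
theorem sum_QZeroAB_23_bound (C : ℕ) :
    ∃ c : ℝ, 0 < c ∧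
      ∀ (m : ℕ) (S : ℕ → Finset Pt) (lam : ℕ → ℝ),
        1 ≤ m →
        (∀ i ≤ m, ∀ j ≤ m, i ≠ j → Disjoint (S i) (S j)) →
        (∀ j ≤ m, (S j).card ≤ 2 ^ j) →
        (∀ j ≤ m, 0 ≤ lam j) →
        (∀ j ≤ m, ∀ ξ ∈ S j, ∀ ℓ₁ ℓ₂ : Set (ℝ × ℝ), IsLine ℓ₁ → IsLine ℓ₂ →
          emb ξ ∈ ℓ₁ → emb ξ ∈ ℓ₂ →
          (2 : ℝ) ^ ((j : ℝ) / 2 + (C : ℝ)) ≤ (lineCount ℓ₁ (S j) : ℝ) →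
          (2 : ℝ) ^ ((j : ℝ) / 2 + (C : ℝ)) ≤ (lineCount ℓ₂ (S j) : ℝ) → ℓ₁ = ℓ₂) →
        (∑' Q : Quad, Set.indicator (QZeroAB S C m 2 3) (fQ (fWt S lam m)) Q ≤
            c * (∑ j ∈ Finset.range (m + 1), lam j ^ 2) ^ 2) ∧
          (∑' Q : Quad, Set.indicator (QZeroAB S C m 3 2) (fQ (fWt S lam m)) Q ≤
            c * (∑ j ∈ Finset.range (m + 1), lam j ^ 2) ^ 2) := by
  obtain ⟨K, hK0, hK⟩ := exists_sum_decay_le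
  refine ⟨4 * K ^ 2, by positivity, fun m S lam _ hS hcard hlam _ => ⟨?_, ?_⟩⟩
  · exact tsum_indicator_QZeroAB_three_le hK hS hcard hlam
  · rw [tsum_indicator_QZeroAB_swap]
    exact tsum_indicator_QZeroAB_three_le hK hS hcard hlam
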